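/- For any real s ≥ 0, there exists a finite set 𝒯 of low-defect polynomials such that for every positive integer n, one has δ(n) < s if and only if there is some f ∈ 𝒯 (say of degree r) and nonnegative integers k₁,…,k_{r+1} with n = f(3^{k₁},…,3^{k_r})·3^{k_{r+1}}. -/

import Mathlib

/-- `CpxW n k` : the positive integer `n` can be written using exactly `k` ones,
with an arbitrary combination of additions and multiplications. -/
inductive CpxW : ℕ → ℕ → Prop
  | one : CpxW 1 1
  | add {a b m n : ℕ} : CpxW a m → CpxW b n → CpxW (a + b) (m + n)
  | mul {a b m n : ℕ} : CpxW a m → CpxW b n → CpxW (a * b) (m + n)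

/-- The integer complexity `‖n‖`: the least number of 1's needed to write `n`
using additions and multiplications. -/
noncomputable def cpx (n : ℕ) : ℕ := sInf {k | CpxW n k}

/-- The defect `δ(n) = ‖n‖ - 3 log₃ n`. -/
noncomputable def defect (n : ℕ) : ℝ := (cpx n : ℝ) - 3 * Real.logb 3 (n : ℝ)

/-- `LDP r f C` : `(f, C)` is a low-defect pair of degree `r`; here a low-defect
polynomial of degree `r` is written in the variables `X 0, …, X (r-1)`. -/
inductive LDP : ℕ → MvPolynomial ℕ ℤ → ℕ → Prop
  | const (k C : ℕ) (hk : 0 < k) (hC : cpx k ≤ C) :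
      LDP 0 (MvPolynomial.C (k : ℤ)) C
  | mul {r₁ r₂ : ℕ} {f₁ f₂ : MvPolynomial ℕ ℤ} {C₁ C₂ : ℕ} :
      LDP r₁ f₁ C₁ → LDP r₂ f₂ C₂ →
      LDP (r₁ + r₂) (f₁ * MvPolynomial.rename (· + r₁) f₂) (C₁ + C₂)
  | step {r : ℕ} {f : MvPolynomial ℕ ℤ} {C : ℕ} (c D : ℕ) (hc : 0 < c) (hD : cpx c ≤ D) :
      LDP r f C → LDP (r + 1) (f * MvPolynomial.X r + MvPolynomial.C (c : ℤ)) (C + D)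

/-- A low-defect polynomial: the first component of some low-defect pair. -/
def LowDefectPoly (f : MvPolynomial ℕ ℤ) : Prop := ∃ r C, LDP r f C

/-- The leading coefficient of a low-defect polynomial of degree `r`:
the coefficient of `x₁ ⋯ x_r`. -/
noncomputable def leadCoeff (r : ℕ) (f : MvPolynomial ℕ ℤ) : ℤ :=
  MvPolynomial.coeff (∑ i ∈ Finset.range r, Finsupp.single i 1) f

/-- The defect `δ(f,C) = C - 3 log₃ a` of a low-defect pair of degree `r`,
where `a` is the leading coefficient. -/
noncomputable def pairDft (r : ℕ) (f : MvPolynomial ℕ ℤ) (C : ℕ) : ℝ :=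
  (C : ℝ) - 3 * Real.logb 3 ((leadCoeff r f : ℤ) : ℝ)

/-- `f(3^{k₁}, …, 3^{k_r})` for a polynomial of degree `r`. -/
noncomputable def eval3 (r : ℕ) (f : MvPolynomial ℕ ℤ) (k : ℕ → ℕ) : ℤ :=
  MvPolynomial.eval (fun i => if i < r then (3 : ℤ) ^ (k i) else 1) f

/-- `δ_{f,C}(k₁,…,k_r) = C + 3(k₁+⋯+k_r) - 3 log₃ f(3^{k₁},…,3^{k_r})`. -/
noncomputable def dftF (r : ℕ) (f : MvPolynomial ℕ ℤ) (C : ℕ) (k : ℕ → ℕ) : ℝ :=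
  (C : ℝ) + 3 * (∑ i ∈ Finset.range r, (k i : ℝ))
    - 3 * Real.logb 3 ((eval3 r f k : ℤ) : ℝ)

/-- The nesting order: `NestLe f i j` means `xᵢ ⪯ xⱼ`, i.e. every monomial of `f`
divisible by `xᵢ` is divisible by `xⱼ`. -/
def NestLe (f : MvPolynomial ℕ ℤ) (i j : ℕ) : Prop :=
  ∀ m ∈ f.support, m i ≠ 0 → m j ≠ 0

/-- `xᵢ` is a variable of (the degree-`r` polynomial) `f` that is minimal with
respect to the nesting order. -/
def IsMinVar (r : ℕ) (f : MvPolynomial ℕ ℤ) (i : ℕ) : Prop :=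
  i < r ∧ ∀ j < r, NestLe f j i → NestLe f i j

/-- Substituting `3^k` for the variable `xᵢ` of `f`, renumbering the later
variables down by one. -/
noncomputable def truncAt (f : MvPolynomial ℕ ℤ) (i k : ℕ) : MvPolynomial ℕ ℤ :=
  MvPolynomial.aeval (fun j => if j < i then MvPolynomial.X j
    else if j = i then MvPolynomial.C ((3 : ℤ) ^ k) else MvPolynomial.X (j - 1)) f

/-- A direct truncation of a "pair with degree" `(r, f, C)`: substitute `3^k`
into a variable of `f` minimal in the nesting order. -/
def DirectTrunc (a b : ℕ × MvPolynomial ℕ ℤ × ℕ) : Prop :=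
  ∃ i k : ℕ, a.1 = b.1 + 1 ∧ IsMinVar a.1 a.2.1 i ∧
    b.2.1 = truncAt a.2.1 i k ∧ b.2.2 = a.2.2 + 3 * k

/-- `n` is a leader: either `3 ∤ n`, or `3 ∣ n` and `‖n‖ < ‖n/3‖ + 3`. -/
def IsLeader (n : ℕ) : Prop := 0 < n ∧ (3 ∣ n → cpx n < cpx (n / 3) + 3)

/-- `(f, C)` (of degree `r`) efficiently 3-represents `n`. -/
def EffRep (r : ℕ) (f : MvPolynomial ℕ ℤ) (C : ℕ) (n : ℕ) : Prop :=
  ∃ k : ℕ → ℕ, (n : ℤ) = eval3 r f k ∧ cpx n = C + 3 * ∑ i ∈ Finset.range r, k i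

/-- The number of `∗`-entries (free coordinates) of `p` among `0, …, r-1`. -/
def starCount (r : ℕ) (p : ℕ → Option ℕ) : ℕ :=
  ((Finset.range r).filter (fun i => p i = none)).card

/-- The 3-substitution of a tuple `p ∈ (ℤ≥0 ∪ {∗})^r` into `f`: substitute
`3^{kᵢ}` for `xᵢ` whenever `p i = some kᵢ`, renumbering the surviving variables
in increasing order. -/
noncomputable def subst3 (f : MvPolynomial ℕ ℤ) (p : ℕ → Option ℕ) : MvPolynomial ℕ ℤ :=
  MvPolynomial.aeval (fun j =>
    match p j with
    | some k => MvPolynomial.C ((3 : ℤ) ^ k)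
    | none => MvPolynomial.X (((Finset.range j).filter (fun i => p i = none)).card)) f

/-- The insertion map `ι` associated to `p`: inserts the arguments into the
coordinates of `p` equal to `∗`. -/
def iotaMap (p : ℕ → Option ℕ) (ℓ : ℕ → ℕ) : ℕ → ℕ := fun j =>
  match p j with
  | some k => k
  | none => ℓ (((Finset.range j).filter (fun i => p i = none)).card)

theorem CpxW.pos {n k : ℕ} (h : CpxW n k) : 0 < n ∧ 0 < k := by
  induction h with
  | one => simp
  | add _ _ h₁ h₂ => omega
  | mul _ _ h₁ h₂ => exact ⟨Nat.mul_pos h₁.1 h₂.1, by omega⟩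

theorem exists_cpxW {n : ℕ} (hn : 0 < n) : ∃ k, CpxW n k := by
  induction n, hn using Nat.le_induction with
  | base => exact ⟨1, .one⟩
  | succ n _ ih =>
    obtain ⟨k, hk⟩ := ih
    exact ⟨k + 1, hk.add .one⟩

theorem cpxW_cpx {n : ℕ} (hn : 0 < n) : CpxW n (cpx n) :=
  Nat.sInf_mem (s := {k | CpxW n k}) (exists_cpxW hn)

theorem CpxW.cpx_le {n k : ℕ} (h : CpxW n k) : cpx n ≤ k := Nat.sInf_le h

theorem cpx_add_le {a b : ℕ} (ha : 0 < a) (hb : 0 < b) : cpx (a + b) ≤ cpx a + cpx b :=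
  ((cpxW_cpx ha).add (cpxW_cpx hb)).cpx_le

theorem cpx_mul_le {a b : ℕ} (ha : 0 < a) (hb : 0 < b) : cpx (a * b) ≤ cpx a + cpx b :=
  ((cpxW_cpx ha).mul (cpxW_cpx hb)).cpx_le

theorem cpx_three_le : cpx 3 ≤ 3 :=
  (CpxW.add (CpxW.add .one .one) .one).cpx_le

theorem cpx_mul_three_pow_le {a : ℕ} (ha : 0 < a) (m : ℕ) :
    cpx (a * 3 ^ m) ≤ cpx a + 3 * m := by
  induction m with
  | zero => simp
  | succ m ih =>
    have := cpx_mul_le (a := a * 3 ^ m) (b := 3) (by positivity) (by norm_num)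
    have := cpx_three_le
    rw [pow_succ, ← mul_assoc]
    omega

theorem CpxW.cube_le {n k : ℕ} (h : CpxW n k) : n ^ 3 ≤ 3 ^ k := by
  have succ_case : ∀ {a m l : ℕ}, 0 < a → 0 < m → 0 < l → a ^ 3 ≤ 3 ^ m →
      (a + 1) ^ 3 ≤ 3 ^ (m + l) := by
    intro a m l ha hm hl h
    have hle : 3 ^ (m + 1) ≤ 3 ^ (m + l) := Nat.pow_le_pow_right (by norm_num) (by omega)
    refine le_trans ?_ hle
    rcases Nat.lt_or_ge a 3 with h3 | h3
    · interval_cases a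
      · have : 3 ^ 2 ≤ 3 ^ (m + 1) := Nat.pow_le_pow_right (by norm_num) (by omega)
        omega
      · have hm2 : 2 ≤ m := by
          by_contra hlt
          have : m = 1 := by omega
          subst this
          norm_num at h
        have : 3 ^ 3 ≤ 3 ^ (m + 1) := Nat.pow_le_pow_right (by norm_num) (by omega)
        omega
    · have : (a + 1) ^ 3 ≤ 3 * a ^ 3 := by
        obtain ⟨d, rfl⟩ := Nat.exists_eq_add_of_le h3
        ring_nf
        nlinarith [Nat.zero_le (d ^ 3), Nat.zero_le (d ^ 2)]
      rw [pow_succ 3 m]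
      omega
  induction h with
  | one => norm_num
  | @mul a b m n h₁ h₂ i₁ i₂ =>
    rw [mul_pow, pow_add]
    exact Nat.mul_le_mul i₁ i₂
  | @add a b m n h₁ h₂ i₁ i₂ =>
    have p₁ := h₁.pos
    have p₂ := h₂.pos
    rcases Nat.lt_or_ge b 2 with hb | hb
    · obtain rfl : b = 1 := by omega
      exact succ_case p₁.1 p₁.2 p₂.2 i₁
    rcases Nat.lt_or_ge a 2 with ha | ha
    · obtain rfl : a = 1 := by omega
      rw [add_comm, add_comm m]
      exact succ_case p₂.1 p₂.2 p₁.2 i₂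
    · have : a + b ≤ a * b := by nlinarith
      calc (a + b) ^ 3 ≤ (a * b) ^ 3 := Nat.pow_le_pow_left this 3
        _ = a ^ 3 * b ^ 3 := mul_pow _ _ _
        _ ≤ 3 ^ m * 3 ^ n := Nat.mul_le_mul i₁ i₂
        _ = 3 ^ (m + n) := (pow_add _ _ _).symm

theorem cube_le_three_pow_cpx {n : ℕ} (hn : 0 < n) : n ^ 3 ≤ 3 ^ cpx n := (cpxW_cpx hn).cube_le

theorem cpx_pos {n : ℕ} (hn : 0 < n) : 0 < cpx n := (cpxW_cpx hn).pos.2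

theorem two_le_cpx {n : ℕ} (hn : 2 ≤ n) : 2 ≤ cpx n := by
  by_contra h
  have h₁ : 3 ^ cpx n ≤ 3 ^ 1 := Nat.pow_le_pow_right (by norm_num) (by omega)
  have h₂ := cube_le_three_pow_cpx (n := n) (by omega)
  have h₃ : 2 ^ 3 ≤ n ^ 3 := Nat.pow_le_pow_left hn 3
  omega

theorem cpx_three : cpx 3 = 3 := by
  refine le_antisymm cpx_three_le ?_
  by_contra h
  have h₁ : 3 ^ cpx 3 ≤ 3 ^ 2 := Nat.pow_le_pow_right (by norm_num) (by omega)
  have h₂ := cube_le_three_pow_cpx (n := 3) (by omega)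
  omega

/-- Every positive integer other than `1` is most efficiently a sum or a nontrivial product. -/
theorem cpx_decomposition {n : ℕ} (hn : 0 < n) :
    n = 1 ∨ (∃ a b, 0 < b ∧ b ≤ a ∧ n = a + b ∧ cpx n = cpx a + cpx b) ∨
      ∃ a b, 1 < a ∧ 1 < b ∧ n = a * b ∧ cpx n = cpx a + cpx b := by
  have h := cpxW_cpx hn
  generalize hk : cpx n = k at h
  cases h with
  | one => exact .inl rfl
  | @add a b m l h₁ h₂ =>
    have := h₁.cpx_le
    have := h₂.cpx_le
    have := cpx_add_le h₁.pos.1 h₂.pos.1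
    refine .inr (.inl ?_)
    rcases le_total b a with hab | hab
    · exact ⟨a, b, h₂.pos.1, hab, rfl, by omega⟩
    · exact ⟨b, a, h₁.pos.1, hab, add_comm _ _, by omega⟩
  | @mul a b m l h₁ h₂ =>
    have c₁ := h₁.cpx_le
    have c₂ := h₂.cpx_le
    have p₁ := h₁.pos
    have p₂ := h₂.pos
    have := cpx_mul_le p₁.1 p₂.1
    refine .inr (.inr ⟨a, b, ?_, ?_, rfl, by omega⟩)
    · by_contra ha
      obtain rfl : a = 1 := by omega
      rw [one_mul] at hk
      omega
    · by_contra hb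
      obtain rfl : b = 1 := by omega
      rw [mul_one] at hk
      omega

/-- In an efficient sum `a + b` with `b ≤ a` other than `1 + 1` and `2 + 1`, the defect of `a`
is smaller than that of `a + b` by at least `log₃ (9 / 8)`. -/
theorem summand_bound {a b N : ℕ} (hb : 0 < b) (hba : b ≤ a) (hab : 3 < a + b)
    (h : 3 ^ (cpx a + cpx b) * 8 ^ (N + 1) < 9 ^ (N + 1) * (a + b) ^ 3) :
    3 ^ cpx a * 8 ^ N < 9 ^ N * a ^ 3 := by
  rw [pow_add, pow_succ, pow_succ] at h
  have hX : 0 < 3 ^ cpx a * 8 ^ N := by positivity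
  rcases Nat.lt_or_ge b 2 with hb2 | hb2
  · obtain rfl : b = 1 := by omega
    have h1 : 3 ^ 1 ≤ 3 ^ cpx 1 := Nat.pow_le_pow_right (by norm_num) (cpx_pos one_pos)
    have h2 : 27 * (a + 1) ^ 3 ≤ 64 * a ^ 3 := by
      obtain ⟨d, rfl⟩ := Nat.exists_eq_add_of_le (show 3 ≤ a by omega)
      ring_nf
      nlinarith [Nat.zero_le (d ^ 3), Nat.zero_le (d ^ 2)]
    have h3 := Nat.mul_le_mul_left (3 ^ cpx a * 8 ^ N) h1
    have h4 := Nat.mul_le_mul_left (9 ^ N) h2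
    nlinarith
  · have h1 : 3 ^ 2 ≤ 3 ^ cpx b := Nat.pow_le_pow_right (by norm_num) (two_le_cpx hb2)
    have h2 : (a + b) ^ 3 ≤ 8 * a ^ 3 := by
      calc (a + b) ^ 3 ≤ (2 * a) ^ 3 := Nat.pow_le_pow_left (by omega) 3
        _ = 8 * a ^ 3 := by ring
    have h3 := Nat.mul_le_mul_left (3 ^ cpx a * 8 ^ N) h1
    have h4 := Nat.mul_le_mul_left (9 ^ N) h2
    nlinarith

theorem addend_bound {a b N : ℕ} (hb : 0 < b) (hba : b ≤ a)
    (h : 3 ^ (cpx a + cpx b) * 8 ^ (N + 1) < 9 ^ (N + 1) * (a + b) ^ 3) :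
    b < 9 ^ (N + 1) := by
  rw [pow_add] at h
  have h1 := cube_le_three_pow_cpx (n := a) (by omega)
  have h2 := cube_le_three_pow_cpx hb
  have h3 : (a + b) ^ 3 ≤ 8 * 3 ^ cpx a := by
    calc (a + b) ^ 3 ≤ (2 * a) ^ 3 := Nat.pow_le_pow_left (by omega) 3
      _ = 8 * a ^ 3 := by ring
      _ ≤ _ := by omega
  have h4 : b ≤ b ^ 3 := Nat.le_self_pow (by norm_num) b
  have h5 : 3 ^ cpx a * 8 * (3 ^ cpx b * 8 ^ N) < 3 ^ cpx a * 8 * 9 ^ (N + 1) := by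
    have := Nat.mul_le_mul_left (9 ^ (N + 1)) h3
    rw [pow_succ 8] at h
    nlinarith
  have h6 := Nat.lt_of_mul_lt_mul_left h5
  have h7 : 3 ^ cpx b * 1 ≤ 3 ^ cpx b * 8 ^ N := Nat.mul_le_mul_left _ (Nat.one_le_pow _ _ (by norm_num))
  omega

/-- The defect of a number is either `0`, for powers of `3`, or at least `log₃ (9 / 8)`. -/
theorem eq_three_pow_of_small {n : ℕ} (hn : 0 < n) (h : 3 ^ cpx n * 8 < 9 * n ^ 3) :
    ∃ m, n = 3 ^ m ∧ cpx n = 3 * m := by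
  induction n using Nat.strong_induction_on with
  | _ n ih =>
  rcases cpx_decomposition hn with rfl | ⟨a, b, hb, hba, rfl, hc⟩ | ⟨a, b, ha, hb, rfl, hc⟩
  · have : 3 ^ 1 ≤ 3 ^ cpx 1 := Nat.pow_le_pow_right (by norm_num) (cpx_pos one_pos)
    omega
  · rcases Nat.lt_or_ge 3 (a + b) with h3 | h3
    · have := summand_bound (N := 0) hb hba h3 (by rw [← hc]; simpa using h)
      have := cube_le_three_pow_cpx (n := a) (by omega)
      omega
    · obtain ⟨rfl, rfl⟩ | ⟨rfl, rfl⟩ : a = 1 ∧ b = 1 ∨ a = 2 ∧ b = 1 := by omega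
      · have : 3 ^ 2 ≤ 3 ^ cpx 2 := Nat.pow_le_pow_right (by norm_num) (two_le_cpx le_rfl)
        norm_num at h
        omega
      · exact ⟨1, rfl, cpx_three⟩
  · rw [hc, pow_add, mul_pow] at h
    have ca := cube_le_three_pow_cpx (n := a) (by omega)
    have cb := cube_le_three_pow_cpx (n := b) (by omega)
    have pa : 0 < a ^ 3 := by positivity
    have pb : 0 < b ^ 3 := by positivity
    obtain ⟨i, hi, hi'⟩ := ih a (by nlinarith) (by omega) (by
      by_contra hlt
      have := Nat.mul_le_mul (not_lt.1 hlt) cb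
      nlinarith)
    obtain ⟨j, hj, hj'⟩ := ih b (by nlinarith) (by omega) (by
      by_contra hlt
      have := Nat.mul_le_mul ca (not_lt.1 hlt)
      nlinarith)
    exact ⟨i + j, by rw [hi, hj, pow_add], by omega⟩

/-- Construction trees of low-defect pairs. The constants carry a complexity bound. -/
inductive LDTree : Type
  | const (k A : ℕ) : LDTree
  | mul (f g : LDTree) : LDTree
  | step (f : LDTree) (c : ℕ) : LDTree

namespace LDTree

/-- The positivity and complexity conditions making a tree a low-defect pair. -/
def Valid : LDTree → Prop
  | const k A => 0 < k ∧ cpx k ≤ A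
  | mul f g => f.Valid ∧ g.Valid
  | step f c => f.Valid ∧ 0 < c

/-- The degree of the polynomial. -/
def deg : LDTree → ℕ
  | const _ _ => 0
  | mul f g => f.deg + g.deg
  | step f _ => f.deg + 1

/-- The base complexity of the pair. -/
noncomputable def base : LDTree → ℕ
  | const _ A => A
  | mul f g => f.base + g.base
  | step f c => f.base + cpx c

/-- The polynomial of the pair. -/
noncomputable def poly : LDTree → MvPolynomial ℕ ℤ
  | const k _ => MvPolynomial.C (k : ℤ)
  | mul f g => f.poly * MvPolynomial.rename (· + f.deg) g.poly
  | step f c => f.poly * MvPolynomial.X f.deg + MvPolynomial.C (c : ℤ)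

/-- `T.Val n σ` : the polynomial of `T` takes the value `n` at powers of `3` whose exponents
sum to `σ`. -/
def Val : LDTree → ℕ → ℕ → Prop
  | const k _, n, σ => n = k ∧ σ = 0
  | mul f g, n, σ => ∃ u i v j, f.Val u i ∧ g.Val v j ∧ n = u * v ∧ σ = i + j
  | step f c, n, σ => ∃ u i m, f.Val u i ∧ n = u * 3 ^ m + c ∧ σ = i + m

theorem Valid.ldp {T : LDTree} (h : T.Valid) : LDP T.deg T.poly T.base := by
  induction T with
  | const k A => exact .const k A h.1 h.2
  | mul f g hf hg => exact .mul (hf h.1) (hg h.2)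
  | step f c hf => exact .step c _ h.2 le_rfl (hf h.1)

theorem eval_poly_congr (T : LDTree) {x y : ℕ → ℤ} (h : ∀ i < T.deg, x i = y i) :
    MvPolynomial.eval x T.poly = MvPolynomial.eval y T.poly := by
  induction T generalizing x y with
  | const k A => simp [poly]
  | mul f g hf hg =>
    simp only [deg] at h
    simp only [poly, map_mul, MvPolynomial.eval_rename, Function.comp_def]
    rw [hf fun i hi => h i (by omega), hg fun i hi => h (i + f.deg) (by omega)]
  | step f c hf =>
    simp only [deg] at h
    simp only [poly, map_mul, map_add, MvPolynomial.eval_X, MvPolynomial.eval_C]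
    rw [hf fun i hi => h i (by omega), h f.deg (by omega)]

theorem exists_val (T : LDTree) (k : ℕ → ℕ) :
    ∃ n σ, T.Val n σ ∧ MvPolynomial.eval (fun i => (3 : ℤ) ^ k i) T.poly = n := by
  induction T generalizing k with
  | const a A => exact ⟨a, 0, ⟨rfl, rfl⟩, by simp [poly]⟩
  | mul f g hf hg =>
    obtain ⟨u, i, hu, eu⟩ := hf k
    obtain ⟨v, j, hv, ev⟩ := hg fun i => k (i + f.deg)
    refine ⟨u * v, i + j, ⟨u, i, v, j, hu, hv, rfl, rfl⟩, ?_⟩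
    simp only [poly, map_mul, MvPolynomial.eval_rename, Function.comp_def]
    rw [eu, ev, Nat.cast_mul]
  | step f c hf =>
    obtain ⟨u, i, hu, eu⟩ := hf k
    refine ⟨u * 3 ^ k f.deg + c, _, ⟨u, i, _, hu, rfl, rfl⟩, ?_⟩
    simp [poly, eu]

theorem Val.exists_eval {T : LDTree} {n σ : ℕ} (h : T.Val n σ) :
    ∃ k : ℕ → ℕ, MvPolynomial.eval (fun i => (3 : ℤ) ^ k i) T.poly = n := by
  induction T generalizing n σ with
  | const a A => exact ⟨0, by simp [poly, h.1]⟩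
  | mul f g hf hg =>
    obtain ⟨u, i, v, j, hu, hv, rfl, -⟩ := h
    obtain ⟨k, hk⟩ := hf hu
    obtain ⟨l, hl⟩ := hg hv
    refine ⟨fun i => if i < f.deg then k i else l (i - f.deg), ?_⟩
    simp only [poly, map_mul, MvPolynomial.eval_rename, Nat.cast_mul]
    rw [← hk, ← hl]
    congr 1
    · exact eval_poly_congr f fun i hi => by simp [hi]
    · exact eval_poly_congr g fun i hi => by simp
  | step f c hf =>
    obtain ⟨u, i, m, hu, rfl, -⟩ := h
    obtain ⟨k, hk⟩ := hf hu
    refine ⟨fun i => if i < f.deg then k i else m, ?_⟩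
    have : MvPolynomial.eval (fun i => (3 : ℤ) ^ (if i < f.deg then k i else m)) f.poly = u := by
      rw [← hk]
      exact eval_poly_congr f fun i hi => by simp [hi]
    simp only [poly, map_mul, map_add, MvPolynomial.eval_X, MvPolynomial.eval_C, this]
    simp

theorem Valid.val_bound {T : LDTree} (hT : T.Valid) {n σ : ℕ} (h : T.Val n σ) :
    0 < n ∧ cpx n ≤ T.base + 3 * σ := by
  induction T generalizing n σ with
  | const k A =>
    obtain ⟨rfl, rfl⟩ := h
    exact hT
  | mul f g hf hg =>
    obtain ⟨u, i, v, j, hu, hv, rfl, rfl⟩ := h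
    obtain ⟨pu, cu⟩ := hf hT.1 hu
    obtain ⟨pv, cv⟩ := hg hT.2 hv
    have := cpx_mul_le pu pv
    exact ⟨by positivity, by simp only [base]; omega⟩
  | step f c hf =>
    obtain ⟨u, i, m, hu, rfl, rfl⟩ := h
    obtain ⟨pu, cu⟩ := hf hT.1 hu
    have := cpx_mul_three_pow_le pu m
    have := cpx_add_le (a := u * 3 ^ m) (by positivity) hT.2
    exact ⟨by positivity, by simp only [base]; omega⟩

theorem Val.unique_of_deg_eq_zero {T : LDTree} (hT : T.deg = 0) {n σ n' σ' : ℕ}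
    (h : T.Val n σ) (h' : T.Val n' σ') : n = n' ∧ σ = 0 ∧ σ' = 0 := by
  induction T generalizing n σ n' σ' with
  | const k A => exact ⟨h.1.trans h'.1.symm, h.2, h'.2⟩
  | mul f g hf hg =>
    obtain ⟨u, i, v, j, hu, hv, rfl, rfl⟩ := h
    obtain ⟨u', i', v', j', hu', hv', rfl, rfl⟩ := h'
    simp only [deg] at hT
    obtain ⟨rfl, rfl, rfl⟩ := hf (by omega) hu hu'
    obtain ⟨rfl, rfl, rfl⟩ := hg (by omega) hv hv'
    exact ⟨rfl, rfl, rfl⟩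
  | step f c hf => simp [deg] at hT

/-- Given a value of `T`, all but finitely many choices of the exponents of the minimal variables
lead to at least the defect of that value; the others are values of finitely many truncations. -/
theorem exists_truncations {T : LDTree} (hT : T.Valid) {n₀ σ₀ : ℕ} (h₀ : T.Val n₀ σ₀) (L : ℕ) :
    ∃ S : Set LDTree, S.Finite ∧ (∀ U ∈ S, U.Valid ∧ U.deg < T.deg) ∧
      ∀ n σ, T.Val n σ →
        (∃ U ∈ S, ∃ τ, U.Val n τ ∧ U.base + 3 * τ = T.base + 3 * σ) ∨
        (n * 3 ^ σ₀ ≤ n₀ * 3 ^ σ ∧ (T.deg = 0 ∨ L ≤ σ)) := by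
  induction T generalizing n₀ σ₀ L with
  | const k A =>
    refine ⟨∅, Set.finite_empty, by simp, fun n σ h => .inr ?_⟩
    obtain ⟨rfl, rfl⟩ := h
    obtain ⟨rfl, rfl⟩ := h₀
    exact ⟨le_rfl, .inl rfl⟩
  | mul f g hf hg =>
    obtain ⟨u₀, i₀, v₀, j₀, hu₀, hv₀, rfl, rfl⟩ := h₀
    obtain ⟨S₁, fin₁, val₁, cov₁⟩ := hf hT.1 hu₀ L
    obtain ⟨S₂, fin₂, val₂, cov₂⟩ := hg hT.2 hv₀ L
    refine ⟨(mul · g) '' S₁ ∪ (mul f) '' S₂, (fin₁.image _).union (fin₂.image _), ?_, ?_⟩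
    · rintro _ (⟨U, hU, rfl⟩ | ⟨U, hU, rfl⟩)
      · exact ⟨⟨(val₁ U hU).1, hT.2⟩, Nat.add_lt_add_right (val₁ U hU).2 _⟩
      · exact ⟨⟨hT.1, (val₂ U hU).1⟩, Nat.add_lt_add_left (val₂ U hU).2 _⟩
    · rintro _ _ ⟨u, i, v, j, hu, hv, rfl, rfl⟩
      rcases cov₁ u i hu with ⟨U, hU, τ, hτ, e⟩ | ⟨le₁, d₁⟩
      · exact .inl ⟨_, .inl ⟨U, hU, rfl⟩, τ + j, ⟨u, τ, v, j, hτ, hv, rfl, rfl⟩, by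
          simp only [base]; omega⟩
      rcases cov₂ v j hv with ⟨U, hU, τ, hτ, e⟩ | ⟨le₂, d₂⟩
      · exact .inl ⟨_, .inr ⟨U, hU, rfl⟩, i + τ, ⟨u, i, v, τ, hu, hτ, rfl, rfl⟩, by
          simp only [base]; omega⟩
      refine .inr ⟨?_, by simp only [deg]; omega⟩
      have := Nat.mul_le_mul le₁ le₂
      rw [pow_add, pow_add]
      linarith
  | step f c hf =>
    obtain ⟨u₀, i₀, m₀, hu₀, rfl, rfl⟩ := h₀
    by_cases hd : f.deg = 0
    · refine ⟨(fun m => const (u₀ * 3 ^ m + c) (f.base + 3 * m + cpx c)) '' Set.Iio (max m₀ L),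
        (Set.finite_Iio _).image _, ?_, ?_⟩
      · rintro _ ⟨m, -, rfl⟩
        have hv : (step f c).Val (u₀ * 3 ^ m + c) (i₀ + m) := ⟨u₀, i₀, m, hu₀, rfl, rfl⟩
        obtain ⟨-, rfl, -⟩ := hu₀.unique_of_deg_eq_zero hd hu₀
        have := Valid.val_bound hT hv
        simp only [base] at this
        exact ⟨⟨this.1, by omega⟩, by simp [deg]⟩
      · rintro _ _ ⟨u, i, m, hu, rfl, rfl⟩
        obtain ⟨rfl, rfl, rfl⟩ := hu.unique_of_deg_eq_zero hd hu₀
        rcases Nat.lt_or_ge m (max m₀ L) with hm | hm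
        · exact .inl ⟨_, ⟨m, hm, rfl⟩, 0, ⟨rfl, rfl⟩, by simp only [base]; omega⟩
        · refine .inr ⟨?_, .inr (by omega)⟩
          have : 3 ^ m₀ ≤ 3 ^ m := Nat.pow_le_pow_right (by norm_num) (by omega)
          rw [zero_add, zero_add]
          nlinarith
    · obtain ⟨S, fin, val, cov⟩ := hf hT.1 hu₀ (max (i₀ + m₀) L)
      refine ⟨(step · c) '' S, fin.image _, ?_, ?_⟩
      · rintro _ ⟨U, hU, rfl⟩
        exact ⟨⟨(val U hU).1, hT.2⟩, Nat.add_lt_add_right (val U hU).2 _⟩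
      · rintro _ _ ⟨u, i, m, hu, rfl, rfl⟩
        rcases cov u i hu with ⟨U, hU, τ, hτ, e⟩ | ⟨le, d⟩
        · exact .inl ⟨_, ⟨U, hU, rfl⟩, τ + m, ⟨u, τ, m, hτ, rfl, rfl⟩, by
            simp only [base]; omega⟩
        · refine .inr ⟨?_, .inr (by omega)⟩
          have h₁ : 3 ^ (i₀ + m₀) ≤ 3 ^ (i + m) := Nat.pow_le_pow_right (by norm_num) (by omega)
          have h₂ := Nat.mul_le_mul_left c h₁
          have h₃ := Nat.mul_le_mul_right (3 ^ (m + m₀)) le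
          rw [pow_add] at h₃
          rw [add_mul, add_mul]
          refine Nat.add_le_add ?_ h₂
          rw [pow_add, pow_add]
          linarith

/-- All values of `T` have defect (computed from the pair) less than `log₃ t`. -/
def BoundedBy (T : LDTree) (t : ℝ) : Prop :=
  ∀ n σ, T.Val n σ → (3 : ℝ) ^ (T.base + 3 * σ) < t * (n : ℝ) ^ 3

theorem exists_bounded_cover (t : ℝ) {T : LDTree} (hT : T.Valid) :
    ∃ S : Set LDTree, S.Finite ∧ (∀ U ∈ S, U.Valid ∧ U.BoundedBy t) ∧
      ∀ n σ, T.Val n σ → (3 : ℝ) ^ (T.base + 3 * σ) < t * (n : ℝ) ^ 3 →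
        ∃ U ∈ S, ∃ τ, U.Val n τ := by
  induction hd : T.deg using Nat.strong_induction_on generalizing T with
  | _ d ih =>
  subst hd
  by_cases hB : T.BoundedBy t
  · exact ⟨{T}, Set.finite_singleton _, by simpa using ⟨hT, hB⟩,
      fun n σ h _ => ⟨T, rfl, σ, h⟩⟩
  simp only [BoundedBy, not_forall, not_lt] at hB
  obtain ⟨n₀, σ₀, h₀, hle⟩ := hB
  obtain ⟨S, fin, val, cov⟩ := exists_truncations hT h₀ 0
  choose! F hF using fun U (hU : U ∈ S) => ih U.deg (val U hU).2 (val U hU).1 rfl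
  refine ⟨⋃ U ∈ S, F U, fin.biUnion fun U hU => (hF U hU).1, ?_, ?_⟩
  · intro V hV
    simp only [Set.mem_iUnion] at hV
    obtain ⟨U, hU, hV⟩ := hV
    exact (hF U hU).2.1 V hV
  · intro n σ h hlt
    rcases cov n σ h with ⟨U, hU, τ, hτ, e⟩ | ⟨le, -⟩
    · obtain ⟨V, hV, ρ, hρ⟩ := (hF U hU).2.2 n τ hτ (by rwa [e])
      exact ⟨V, Set.mem_biUnion hU hV, ρ, hρ⟩
    · exfalso
      have pn : (0 : ℝ) < n := by exact_mod_cast (Valid.val_bound hT h).1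
      have pn₀ : (0 : ℝ) < n₀ := by exact_mod_cast (Valid.val_bound hT h₀).1
      have le' : (n : ℝ) * 3 ^ σ₀ ≤ n₀ * 3 ^ σ := by exact_mod_cast le
      have le3 := pow_le_pow_left₀ (by positivity) le' 3
      have ht : 0 < t := by
        by_contra ht
        have : t * (n : ℝ) ^ 3 ≤ 0 := mul_nonpos_of_nonpos_of_nonneg (not_lt.1 ht) (by positivity)
        have : (0 : ℝ) < 3 ^ (T.base + 3 * σ) := by positivity
        linarith
      have e : ∀ τ, (3 : ℝ) ^ (T.base + 3 * τ) = 3 ^ T.base * (3 ^ τ) ^ 3 := fun τ => by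
        rw [pow_add, mul_comm 3, pow_mul]
      rw [e] at hlt hle
      rw [mul_pow, mul_pow] at le3
      set a : ℝ := (3 ^ σ) ^ 3
      set a₀ : ℝ := (3 ^ σ₀) ^ 3
      have pa₀ : 0 < a₀ := by positivity
      have h₁ : 3 ^ T.base * a * (n₀ : ℝ) ^ 3 < t * (n : ℝ) ^ 3 * (n₀ : ℝ) ^ 3 :=
        mul_lt_mul_of_pos_right hlt (by positivity)
      have h₂ := mul_le_mul_of_nonneg_right hle (show 0 ≤ (n : ℝ) ^ 3 by positivity)
      have h₃ := mul_le_mul_of_nonneg_left le3 (show (0 : ℝ) ≤ 3 ^ T.base by positivity)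
      linarith

/-- `n` is efficiently represented, up to a power of `3`, by a member of `S`. -/
def Covers (S : Set LDTree) (n : ℕ) : Prop :=
  ∃ T ∈ S, ∃ u σ m, T.Val u σ ∧ n = u * 3 ^ m ∧ T.base + 3 * σ + 3 * m = cpx n

theorem exists_cover (N : ℕ) :
    ∃ S : Set LDTree, S.Finite ∧ (∀ T ∈ S, T.Valid) ∧
      ∀ n, 0 < n → 3 ^ cpx n * 8 ^ N < 9 ^ N * n ^ 3 → Covers S n := by
  induction N with
  | zero =>
    refine ⟨∅, Set.finite_empty, by simp, fun n hn h => ?_⟩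
    have := cube_le_three_pow_cpx hn
    omega
  | succ N ih =>
    obtain ⟨S, fin, val, cov⟩ := ih
    refine ⟨(fun k => const k (cpx k)) '' Set.Icc 1 3 ∪ Set.image2 mul S S ∪
      Set.image2 step S (Set.Ioo 0 (9 ^ (N + 1))),
      (((Set.finite_Icc _ _).image _).union (fin.image2 _ fin)).union
        (fin.image2 _ (Set.finite_Ioo _ _)), ?_, ?_⟩
    · rintro _ ((⟨k, hk, rfl⟩ | ⟨f, hf, g, hg, rfl⟩) | ⟨f, hf, c, hc, rfl⟩)
      · exact ⟨hk.1, le_rfl⟩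
      · exact ⟨val f hf, val g hg⟩
      · exact ⟨val f hf, hc.1⟩
    intro n
    induction n using Nat.strong_induction_on with
    | _ n ihn =>
    intro hn h
    rcases Nat.lt_or_ge 3 n with h3 | h3
    swap
    · exact ⟨_, .inl (.inl ⟨n, ⟨hn, h3⟩, rfl⟩), n, 0, 0, ⟨rfl, rfl⟩, by simp, by simp [base]⟩
    rcases cpx_decomposition hn with rfl | ⟨a, b, hb, hba, rfl, hc⟩ | ⟨a, b, ha, hb, rfl, hc⟩
    · omega
    · rw [hc] at h
      obtain ⟨T, hT, u, σ, m, hu, rfl, e⟩ := cov a (by omega) (summand_bound hb hba h3 h)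
      exact ⟨_, .inr ⟨T, hT, b, ⟨hb, addend_bound hb hba h⟩, rfl⟩, u * 3 ^ m + b, σ + m, 0,
        ⟨u, σ, m, hu, rfl, rfl⟩, by simp, by simp only [base]; omega⟩
    · have la : a < a * b := by nlinarith
      have lb : b < a * b := by nlinarith
      rw [hc, pow_add, mul_pow] at h
      by_cases sa : 3 ^ cpx a * 8 < 9 * a ^ 3
      · obtain ⟨i, rfl, hi⟩ := eq_three_pow_of_small (by omega) sa
        obtain ⟨T, hT, u, σ, m, hu, rfl, e⟩ := ihn b lb (by omega) (by
          rw [hi, pow_mul', mul_assoc, mul_left_comm (9 ^ (N + 1))] at h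
          exact Nat.lt_of_mul_lt_mul_left h)
        exact ⟨T, hT, u, σ, m + i, hu, by ring, by omega⟩
      by_cases sb : 3 ^ cpx b * 8 < 9 * b ^ 3
      · obtain ⟨i, rfl, hi⟩ := eq_three_pow_of_small (by omega) sb
        obtain ⟨T, hT, u, σ, m, hu, rfl, e⟩ := ihn a la (by omega) (by
          rw [hi, pow_mul' 3 3 i, mul_right_comm, ← mul_assoc] at h
          exact Nat.lt_of_mul_lt_mul_right h)
        exact ⟨T, hT, u, σ, m + i, hu, by ring, by omega⟩
      have pa : 0 < a ^ 3 := by positivity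
      have pb : 0 < b ^ 3 := by positivity
      obtain ⟨T, hT, u, σ, m, hu, hua, e⟩ := cov a (by omega) (by
        by_contra hlt
        have := Nat.mul_le_mul (not_lt.1 hlt) (not_lt.1 sb)
        rw [pow_succ, pow_succ] at h
        linarith)
      obtain ⟨T', hT', u', σ', m', hu', hub, e'⟩ := cov b (by omega) (by
        by_contra hlt
        have := Nat.mul_le_mul (not_lt.1 hlt) (not_lt.1 sa)
        rw [pow_succ, pow_succ] at h
        linarith)
      exact ⟨_, .inl (.inr ⟨T, hT, T', hT', rfl⟩), u * u', σ + σ', m + m',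
        ⟨u, σ, u', σ', hu, hu', rfl, rfl⟩, by rw [hua, hub]; ring, by simp only [base]; omega⟩

end LDTree

theorem defect_lt_iff {n : ℕ} (hn : 0 < n) (s : ℝ) :
    defect n < s ↔ (3 : ℝ) ^ cpx n < (3 : ℝ) ^ s * (n : ℝ) ^ 3 := by
  have pn : (0 : ℝ) < n := by exact_mod_cast hn
  have e : (3 : ℝ) ^ s * (n : ℝ) ^ 3 = (3 : ℝ) ^ (s + 3 * Real.logb 3 n) := by
    rw [Real.rpow_add (by norm_num), mul_comm (3 : ℝ) (Real.logb 3 n),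
      Real.rpow_mul (by norm_num), Real.rpow_logb (by norm_num) (by norm_num) pn]
    norm_cast
  rw [e, ← Real.rpow_natCast, Real.rpow_lt_rpow_left_iff (by norm_num), defect, sub_lt_iff_lt_add]

/-- Representation theorem. For any real `s ≥ 0` there is a finite
set `T` of low-defect polynomials such that a positive integer `n` satisfies
`δ(n) < s` iff `n = f(3^{k₁},…,3^{k_r})·3^{k_{r+1}}` for some `f ∈ T`. -/
theorem representation_theorem (s : ℝ) (hs : 0 ≤ s) :
    ∃ T : Set (MvPolynomial ℕ ℤ), T.Finite ∧ (∀ f ∈ T, LowDefectPoly f) ∧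
      ∀ n : ℕ, 0 < n →
        (defect n < s ↔ ∃ f ∈ T, ∃ r C, LDP r f C ∧
          ∃ (k : ℕ → ℕ) (m : ℕ), (n : ℤ) = eval3 r f k * 3 ^ m) := by
  obtain ⟨N, hN⟩ := pow_unbounded_of_one_lt ((3 : ℝ) ^ s) (show (1 : ℝ) < 9 / 8 by norm_num)
  obtain ⟨S, fin, val, cov⟩ := LDTree.exists_cover N
  choose! F hF using fun U (hU : U ∈ S) => LDTree.exists_bounded_cover ((3 : ℝ) ^ s) (val U hU)
  refine ⟨LDTree.poly '' ⋃ U ∈ S, F U, (fin.biUnion fun U hU => (hF U hU).1).image _, ?_, ?_⟩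
  · rintro _ ⟨V, hV, rfl⟩
    simp only [Set.mem_iUnion] at hV
    obtain ⟨U, hU, hV⟩ := hV
    exact ⟨_, _, ((hF U hU).2.1 V hV).1.ldp⟩
  intro n hn
  rw [defect_lt_iff hn]
  have pn : (0 : ℝ) < n := by exact_mod_cast hn
  constructor
  · intro h
    obtain ⟨U, hU, u, σ, m, hu, rfl, e⟩ := cov n hn (by
      have h₁ := h.trans (mul_lt_mul_of_pos_right hN (show (0 : ℝ) < (n : ℝ) ^ 3 by positivity))
      rw [div_pow, div_mul_eq_mul_div, lt_div_iff₀ (by positivity)] at h₁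
      exact_mod_cast h₁)
    obtain ⟨V, hV, τ, hτ⟩ := (hF U hU).2.2 u σ hu (by
      rw [← e, pow_add, pow_mul' (3 : ℝ) 3 m] at h
      push_cast at h
      rw [mul_pow, ← mul_assoc] at h
      exact lt_of_mul_lt_mul_right h (by positivity))
    obtain ⟨k, hk⟩ := hτ.exists_eval
    refine ⟨V.poly, ⟨V, Set.mem_biUnion hU hV, rfl⟩, V.deg, V.base,
      ((hF U hU).2.1 V hV).1.ldp, k, m, ?_⟩
    rw [eval3, V.eval_poly_congr (y := fun i => (3 : ℤ) ^ k i) fun i hi => by simp [hi], hk]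
    push_cast
    rfl
  · rintro ⟨_, ⟨V, hV, rfl⟩, r, -, -, k, m, e⟩
    simp only [Set.mem_iUnion] at hV
    obtain ⟨U, hU, hV⟩ := hV
    obtain ⟨hvalid, hbdd⟩ := (hF U hU).2.1 V hV
    obtain ⟨u, σ, hu, hk⟩ := V.exists_val fun i => if i < r then k i else 0
    have ek : eval3 r V.poly k = u := by
      rw [← hk, eval3]
      congr 2
      funext i
      split_ifs <;> simp
    rw [ek] at e
    obtain rfl : n = u * 3 ^ m := by exact_mod_cast e
    obtain ⟨pu, cu⟩ := hvalid.val_bound hu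
    have c := cpx_mul_three_pow_le pu m
    calc (3 : ℝ) ^ cpx (u * 3 ^ m) ≤ 3 ^ (V.base + 3 * σ + 3 * m) :=
          pow_le_pow_right₀ (by norm_num) (by omega)
      _ = 3 ^ (V.base + 3 * σ) * (3 ^ m) ^ 3 := by rw [pow_add, pow_mul' (3 : ℝ) 3 m]
      _ < 3 ^ s * (u : ℝ) ^ 3 * (3 ^ m) ^ 3 :=
          mul_lt_mul_of_pos_right (hbdd u σ hu) (by positivity)
      _ = 3 ^ s * ((u * 3 ^ m : ℕ) : ℝ) ^ 3 := by push_cast; ring
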